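/- arXiv:1012.0342 — 2 statements merged into one kernel-verified Lean document; each statement's English description precedes it below -/
import Mathlib

section
/- Let n ≥ 3 and let (A,B) be an admissible Sobolev pair for ℝⁿ. Let q ≥ 2 and let m, p be real numbers with 2 ≤ m ≤ p < ∞, where in addition p ≤ nq/(n−q) in case q < n. Set α := (1/m − 1/p)/(1/m − 1/q + 1/n). Then there exists a constant C (depending only on n, q, m, p) such that every smooth compactly supported u : ℝⁿ → ℝ satisfies ‖u‖_p ≤ C · ‖u‖_m^{1−α} · (A‖∇u‖_q + B‖u‖_q)^{α}. -/
open MeasureTheory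

/-- The `L^p` norm (with respect to Lebesgue measure) of a function on `ℝⁿ`. -/
noncomputable def lpN (n : ℕ) (p : ℝ) (u : EuclideanSpace ℝ (Fin n) → ℝ) : ℝ :=
  (eLpNorm u (ENNReal.ofReal p) volume).toReal

/-- The `L^p` norm of the pointwise norm of the `k`-th iterated derivative. -/
noncomputable def dLpN (n k : ℕ) (p : ℝ) (u : EuclideanSpace ℝ (Fin n) → ℝ) : ℝ :=
  (eLpNorm (fun x => ‖iteratedFDeriv ℝ k u x‖) (ENNReal.ofReal p) volume).toReal

/-- `(A, B)` is an admissible Sobolev pair for `ℝⁿ`: both are positive and the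
Sobolev inequality `‖u‖_{2n/(n-2)} ≤ A ‖∇u‖₂ + B ‖u‖₂` holds for all smooth
compactly supported functions. -/
def SobolevPair (n : ℕ) (A B : ℝ) : Prop :=
  0 < A ∧ 0 < B ∧
    ∀ u : EuclideanSpace ℝ (Fin n) → ℝ, ContDiff ℝ (⊤ : ℕ∞) u → HasCompactSupport u →
      lpN n (2 * (n : ℝ) / ((n : ℝ) - 2)) u ≤ A * dLpN n 1 2 u + B * lpN n 2 u

open scoped ENNReal NNReal

theorem eLpNorm_ofReal_eq_lintegral {α F : Type*} [MeasurableSpace α] [NormedAddCommGroup F]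
    {μ : Measure α} {p : ℝ} (hp : 0 < p) (f : α → F) :
    eLpNorm f (ENNReal.ofReal p) μ = (∫⁻ x, ‖f x‖ₑ ^ p ∂μ) ^ (1 / p) := by
  rw [eLpNorm_eq_lintegral_rpow_enorm_toReal (by simpa using hp) ENNReal.ofReal_ne_top,
    ENNReal.toReal_ofReal hp.le]

/-- Log-convexity of the `L^p` norms in `1 / p`. -/
theorem eLpNorm_le_rpow_mul_rpow {α F : Type*} [MeasurableSpace α] [NormedAddCommGroup F]
    {μ : Measure α} {r s t θ : ℝ} (hr : 0 < r) (hs : 0 < s) (ht : 0 < t) (hθ₀ : 0 ≤ θ)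
    (hθ₁ : θ ≤ 1) (h : 1 / s = (1 - θ) / r + θ / t) {f : α → F} (hf : AEStronglyMeasurable f μ) :
    eLpNorm f (ENNReal.ofReal s) μ ≤
      eLpNorm f (ENNReal.ofReal r) μ ^ (1 - θ) * eLpNorm f (ENNReal.ofReal t) μ ^ θ := by
  simp only [eLpNorm_ofReal_eq_lintegral hr, eLpNorm_ofReal_eq_lintegral hs,
    eLpNorm_ofReal_eq_lintegral ht]
  have hθ' : 0 ≤ 1 - θ := sub_nonneg.2 hθ₁
  have ha : 0 ≤ s * ((1 - θ) / r) := by positivity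
  have hb : 0 ≤ s * (θ / t) := by positivity
  have hab : s * ((1 - θ) / r) + s * (θ / t) = 1 := by
    rw [← mul_add, ← h, mul_one_div_cancel hs.ne']
  have hexp : r * (s * ((1 - θ) / r)) + t * (s * (θ / t)) = s := by field_simp; ring
  calc (∫⁻ x, ‖f x‖ₑ ^ s ∂μ) ^ (1 / s)
      = (∫⁻ x, (‖f x‖ₑ ^ r) ^ (s * ((1 - θ) / r)) * (‖f x‖ₑ ^ t) ^ (s * (θ / t)) ∂μ)
          ^ (1 / s) := by
        congr 2 with x
        rw [← ENNReal.rpow_mul, ← ENNReal.rpow_mul,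
          ← ENNReal.rpow_add_of_nonneg _ _ (by positivity) (by positivity), hexp]
    _ ≤ ((∫⁻ x, ‖f x‖ₑ ^ r ∂μ) ^ (s * ((1 - θ) / r)) *
          (∫⁻ x, ‖f x‖ₑ ^ t ∂μ) ^ (s * (θ / t))) ^ (1 / s) := by
        gcongr
        exact ENNReal.lintegral_mul_norm_pow_le (hf.enorm.pow_const _) (hf.enorm.pow_const _)
          ha hb hab
    _ = _ := by
        rw [ENNReal.mul_rpow_of_nonneg _ _ (by positivity)]
        simp only [← ENNReal.rpow_mul]
        congr 2 <;> field_simp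

/-- The Gagliardo–Nirenberg–Sobolev inequality in `W^{1,1}` applied to `|u|^γ`, followed by
Hölder's inequality. -/
theorem exists_eLpNorm_rpow_le_fderiv {E : Type*} [NormedAddCommGroup E] [NormedSpace ℝ E]
    [MeasurableSpace E] [BorelSpace E] [FiniteDimensional ℝ E] (μ : Measure E)
    [μ.IsAddHaarMeasure] {d q q' γ : ℝ} (hd : Real.HolderConjugate (Module.finrank ℝ E) d)
    (hq : Real.HolderConjugate q q') (hγ : 1 < γ) :
    ∃ C : ℝ≥0, ∀ u : E → ℝ, ContDiff ℝ 1 u → HasCompactSupport u →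
      eLpNorm u (ENNReal.ofReal (γ * d)) μ ^ γ ≤
        C * eLpNorm u (ENNReal.ofReal ((γ - 1) * q')) μ ^ (γ - 1) *
          eLpNorm (fderiv ℝ u) (ENNReal.ofReal q) μ := by
  lift d to ℝ≥0 using hd.symm.nonneg
  lift γ to ℝ≥0 using by linarith
  have hd' : NNReal.HolderConjugate (Module.finrank ℝ E : ℝ≥0) d :=
    NNReal.holderConjugate_coe_iff.1 (by simpa using hd)
  have hd0 : (0 : ℝ) < d := hd.symm.pos
  have hγ0 : (0 : ℝ) < γ := by linarith
  have hγ1 : (0 : ℝ) < γ - 1 := by linarith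
  have hq0 : 0 < q := hq.pos
  have hq'0 : 0 < q' := hq.symm.pos
  refine ⟨eLpNormLESNormFDerivOneConst μ d * γ, fun u hu h2u ↦ ?_⟩
  have hcu := hu.continuous
  have hdu := hu.continuous_fderiv one_ne_zero
  set v : E → ℝ := fun x ↦ ‖u x‖ ^ (γ : ℝ)
  have hv : ContDiff ℝ 1 v := hu.norm_rpow hγ
  have h2v : HasCompactSupport v := h2u.norm.rpow_const hγ0.ne'
  rw [eLpNorm_ofReal_eq_lintegral (by positivity), eLpNorm_ofReal_eq_lintegral (by positivity),
    eLpNorm_ofReal_eq_lintegral hq0]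
  calc ((∫⁻ x, ‖u x‖ₑ ^ (γ * d : ℝ) ∂μ) ^ (1 / (γ * d : ℝ))) ^ (γ : ℝ) = eLpNorm v d μ := by
        rw [eLpNorm_nnreal_eq_lintegral hd'.symm.pos.ne', ← ENNReal.rpow_mul]
        congr 1
        · simp (discharger := positivity) [v, Real.enorm_rpow_of_nonneg, ENNReal.rpow_mul]
        · field_simp
    _ ≤ eLpNormLESNormFDerivOneConst μ d * eLpNorm (fderiv ℝ v) 1 μ :=
        eLpNorm_le_eLpNorm_fderiv_one μ hv h2v hd'
    _ ≤ eLpNormLESNormFDerivOneConst μ d *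
          (γ * ∫⁻ x, ‖u x‖ₑ ^ ((γ : ℝ) - 1) * ‖fderiv ℝ u x‖ₑ ∂μ) := by
        rw [eLpNorm_one_eq_lintegral_enorm, ← lintegral_const_mul γ (by fun_prop)]
        gcongr
        simp_rw [← mul_assoc]
        exact enorm_fderiv_norm_rpow_le (hu.differentiable one_ne_zero) hγ
    _ ≤ eLpNormLESNormFDerivOneConst μ d *
          (γ * ((∫⁻ x, (‖u x‖ₑ ^ ((γ : ℝ) - 1)) ^ q' ∂μ) ^ (1 / q') *
            (∫⁻ x, ‖fderiv ℝ u x‖ₑ ^ q ∂μ) ^ (1 / q))) := by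
        gcongr
        exact ENNReal.lintegral_mul_le_Lp_mul_Lq μ hq.symm (by fun_prop) (by fun_prop)
    _ = _ := by
        simp only [← ENNReal.rpow_mul]
        rw [show 1 / ((γ - 1) * q') * ((γ : ℝ) - 1) = 1 / q' by field_simp]
        push_cast
        ring

theorem dLpN_one_eq (n : ℕ) (p : ℝ) (u : EuclideanSpace ℝ (Fin n) → ℝ) :
    dLpN n 1 p u = (eLpNorm (fderiv ℝ u) (ENNReal.ofReal p) volume).toReal := by
  simp only [dLpN, norm_iteratedFDeriv_one, eLpNorm_norm]

theorem eLpNorm_comp_smul {E F : Type*} [NormedAddCommGroup E] [NormedSpace ℝ E]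
    [MeasurableSpace E] [BorelSpace E] [FiniteDimensional ℝ E] (μ : Measure E)
    [μ.IsAddHaarMeasure] [NormedAddCommGroup F] {p : ℝ} (hp : 0 < p) {r : ℝ} (hr : 0 < r)
    (f : E → F) :
    eLpNorm (fun x ↦ f (r • x)) (ENNReal.ofReal p) μ =
      ENNReal.ofReal (r ^ (-(Module.finrank ℝ E : ℝ) / p)) * eLpNorm f (ENNReal.ofReal p) μ := by
  have h := (Homeomorph.smulOfNeZero r hr.ne' (α := E)).measurableEmbedding.eLpNorm_map_measure
    (g := f) (p := ENNReal.ofReal p) (μ := μ)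
  have hmap : Measure.map (Homeomorph.smulOfNeZero r hr.ne' (α := E)) μ =
      ENNReal.ofReal |(r ^ Module.finrank ℝ E)⁻¹| • μ :=
    Measure.map_addHaar_smul μ hr.ne'
  rw [hmap, eLpNorm_smul_measure_of_ne_top ENNReal.ofReal_ne_top] at h
  refine (h.symm.trans ?_)
  rw [smul_eq_mul, ENNReal.ofReal_rpow_of_pos (by positivity), ENNReal.toReal_div,
    ENNReal.toReal_one, ENNReal.toReal_ofReal hp.le, abs_of_pos (by positivity), ← Real.rpow_natCast, ← Real.rpow_neg hr.le, ← Real.rpow_mul hr.le,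
    mul_one_div]

/-- The gradient constant of an admissible Sobolev pair is bounded below, by scaling. -/
theorem exists_pos_le_of_sobolevPair (n : ℕ) (hn : 3 ≤ n) :
    ∃ a : ℝ, 0 < a ∧ ∀ A B : ℝ, SobolevPair n A B → a ≤ A := by
  have hn3 : (3 : ℝ) ≤ n := by exact_mod_cast hn
  let f : ContDiffBump (0 : EuclideanSpace ℝ (Fin n)) := ⟨1, 2, one_pos, one_lt_two⟩
  have hf : ContDiff ℝ (⊤ : ℕ∞) f := f.contDiff
  have h2f : HasCompactSupport f := f.hasCompactSupport
  set s : ℝ := 2 * (n : ℝ) / ((n : ℝ) - 2) with hs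
  have hs0 : 0 < s := by rw [hs]; apply div_pos <;> linarith
  have hfs : 0 < lpN n s f := by
    refine ENNReal.toReal_pos ?_ (hf.continuous.memLp_of_hasCompactSupport h2f).eLpNorm_ne_top
    rw [Ne, eLpNorm_eq_zero_iff hf.continuous.aestronglyMeasurable (by simpa using hs0),
      hf.continuous.ae_eq_iff_eq volume continuous_zero]
    intro h0
    have := congrFun h0 0
    simp [f.one_of_mem_closedBall (Metric.mem_closedBall_self f.rIn_pos.le)] at this
  have hscale (A B : ℝ) (hAB : SobolevPair n A B) (r : ℝ) (hr : 0 < r) :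
      lpN n s f ≤ A * dLpN n 1 2 f + r⁻¹ * (B * lpN n 2 f) := by
    have h := hAB.2.2 (fun x ↦ f (r • x)) (hf.comp (contDiff_const_smul r))
      (h2f.comp_homeomorph (Homeomorph.smulOfNeZero r hr.ne'))
    rw [dLpN_one_eq] at h ⊢
    have hd : eLpNorm (fderiv ℝ fun x ↦ f (r • x)) (ENNReal.ofReal 2) volume =
        ‖r‖ₑ * eLpNorm (fun x ↦ fderiv ℝ f (r • x)) (ENNReal.ofReal 2) volume := by
      rw [← eLpNorm_const_smul (𝕜 := ℝ) r (fun x ↦ fderiv ℝ f (r • x))]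
      congr 1 with x : 1
      exact fderiv_comp_smul r
    have hL (p : ℝ) (hp : 0 < p) :
        lpN n p (fun x ↦ f (r • x)) = r ^ (-(n : ℝ) / p) * lpN n p f := by
      rw [lpN, eLpNorm_comp_smul volume hp hr, ENNReal.toReal_mul,
        ENNReal.toReal_ofReal (by positivity), finrank_euclideanSpace_fin, lpN]
    rw [← hs, hL s hs0, hL 2 two_pos, hd, eLpNorm_comp_smul volume two_pos hr,
      finrank_euclideanSpace_fin, ENNReal.toReal_mul, ENNReal.toReal_mul,
      ENNReal.toReal_ofReal (by positivity), toReal_enorm, Real.norm_of_nonneg hr.le] at h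
    have e1 : r ^ (-(n : ℝ) / s) = r * r ^ (-(n : ℝ) / 2) := by
      nth_rw 2 [← Real.rpow_one r]
      rw [← Real.rpow_add hr, hs]
      congr 1
      have : (n : ℝ) - 2 ≠ 0 := by linarith
      field_simp
      ring
    rw [e1] at h
    have hpos : 0 < r * r ^ (-(n : ℝ) / 2) := by positivity
    refine le_of_mul_le_mul_left (h.trans_eq ?_) hpos
    field_simp
  have hlim (A B : ℝ) (hAB : SobolevPair n A B) : lpN n s f ≤ A * dLpN n 1 2 f := by
    have ht : Filter.Tendsto (fun r : ℝ ↦ A * dLpN n 1 2 f + r⁻¹ * (B * lpN n 2 f)) Filter.atTop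
        (nhds (A * dLpN n 1 2 f + 0 * (B * lpN n 2 f))) :=
      (tendsto_inv_atTop_zero.mul_const _).const_add _
    rw [zero_mul, add_zero] at ht
    exact ge_of_tendsto ht ((Filter.eventually_gt_atTop 0).mono (hscale A B hAB))
  have hd0 : 0 ≤ dLpN n 1 2 f := ENNReal.toReal_nonneg
  refine ⟨lpN n s f / (dLpN n 1 2 f + 1), by positivity, fun A B hAB ↦ ?_⟩
  rw [div_le_iff₀ (by positivity)]
  nlinarith [hlim A B hAB, hAB.1]

/-- Solving `X ^ γ ≤ C * S ^ (γ - 1) * G` for `X` when `S` interpolates between `M` and `X`. -/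
theorem le_mul_rpow_of_rpow_le {C X M S G γ θ a : ℝ} (hC : 0 ≤ C) (hX : 0 ≤ X) (hM : 0 ≤ M)
    (hS : 0 ≤ S) (hG : 0 ≤ G) (hγ : 1 < γ) (hθ : θ ≤ 1)
    (ha : a * (1 + (1 - θ) * (γ - 1)) = 1)
    (hXS : X ^ γ ≤ C * S ^ (γ - 1) * G) (hSX : S ≤ M ^ (1 - θ) * X ^ θ) :
    X ≤ C ^ a * M ^ (1 - a) * G ^ a := by
  have hk : 0 < 1 + (1 - θ) * (γ - 1) := by
    have := mul_nonneg (sub_nonneg.2 hθ) (sub_pos.2 hγ).le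
    linarith
  have ha0 : 0 < a := by
    by_contra h
    nlinarith
  rcases hX.eq_or_lt with rfl | hX
  · positivity
  have h : X ^ (1 + (1 - θ) * (γ - 1)) ≤ C * M ^ ((1 - θ) * (γ - 1)) * G := by
    have hpos : 0 < X ^ (θ * (γ - 1)) := by positivity
    refine le_of_mul_le_mul_right ?_ hpos
    calc X ^ (1 + (1 - θ) * (γ - 1)) * X ^ (θ * (γ - 1)) = X ^ γ := by
          rw [← Real.rpow_add hX]
          ring_nf
      _ ≤ C * S ^ (γ - 1) * G := hXS
      _ ≤ C * (M ^ (1 - θ) * X ^ θ) ^ (γ - 1) * G := by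
          have : 0 ≤ γ - 1 := by linarith
          gcongr
      _ = _ := by
          rw [Real.mul_rpow (by positivity) (by positivity), ← Real.rpow_mul hM,
            ← Real.rpow_mul hX.le]
          ring
  calc X = (X ^ (1 + (1 - θ) * (γ - 1))) ^ a := by
        rw [← Real.rpow_mul hX.le, mul_comm, ha, Real.rpow_one]
    _ ≤ (C * M ^ ((1 - θ) * (γ - 1)) * G) ^ a := by gcongr
    _ = _ := by
        rw [Real.mul_rpow (by positivity) hG, Real.mul_rpow hC (by positivity),
          ← Real.rpow_mul hM, show (1 - θ) * (γ - 1) * a = 1 - a by linarith]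

theorem lpN_nonneg (n : ℕ) (p : ℝ) (u : EuclideanSpace ℝ (Fin n) → ℝ) : 0 ≤ lpN n p u :=
  ENNReal.toReal_nonneg

theorem dLpN_nonneg (n k : ℕ) (p : ℝ) (u : EuclideanSpace ℝ (Fin n) → ℝ) : 0 ≤ dLpN n k p u :=
  ENNReal.toReal_nonneg

theorem lpN_le_rpow_mul_rpow {n : ℕ} {r s t θ : ℝ} (hr : 0 < r) (hs : 0 < s) (ht : 0 < t)
    (hθ₀ : 0 ≤ θ) (hθ₁ : θ ≤ 1) (h : 1 / s = (1 - θ) / r + θ / t)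
    {u : EuclideanSpace ℝ (Fin n) → ℝ} (hu : Continuous u) (h2u : HasCompactSupport u) :
    lpN n s u ≤ lpN n r u ^ (1 - θ) * lpN n t u ^ θ := by
  have hfin (p : ℝ) : eLpNorm u (ENNReal.ofReal p) volume ≠ ∞ :=
    (hu.memLp_of_hasCompactSupport h2u).eLpNorm_ne_top
  have hθ' : 0 ≤ 1 - θ := sub_nonneg.2 hθ₁
  simp only [lpN, ENNReal.toReal_rpow, ← ENNReal.toReal_mul]
  refine ENNReal.toReal_mono ?_
    (eLpNorm_le_rpow_mul_rpow hr hs ht hθ₀ hθ₁ h hu.aestronglyMeasurable)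
  exact ENNReal.mul_ne_top (ENNReal.rpow_ne_top_of_nonneg hθ' (hfin r))
    (ENNReal.rpow_ne_top_of_nonneg hθ₀ (hfin t))

theorem exists_lpN_rpow_le_dLpN {n : ℕ} {d q q' γ : ℝ} (hd : Real.HolderConjugate n d)
    (hq : Real.HolderConjugate q q') (hγ : 1 < γ) :
    ∃ C : ℝ, 0 ≤ C ∧ ∀ u : EuclideanSpace ℝ (Fin n) → ℝ, ContDiff ℝ 1 u → HasCompactSupport u →
      lpN n (γ * d) u ^ γ ≤ C * lpN n ((γ - 1) * q') u ^ (γ - 1) * dLpN n 1 q u := by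
  obtain ⟨C, hC⟩ := exists_eLpNorm_rpow_le_fderiv
    (volume : Measure (EuclideanSpace ℝ (Fin n))) (d := d) (by simpa using hd) hq hγ
  refine ⟨C, C.2, fun u hu h2u ↦ ?_⟩
  have hfin : eLpNorm u (ENNReal.ofReal ((γ - 1) * q')) volume ≠ ∞ :=
    (hu.continuous.memLp_of_hasCompactSupport h2u).eLpNorm_ne_top
  have hfin' : eLpNorm (fderiv ℝ u) (ENNReal.ofReal q) volume ≠ ∞ :=
    ((hu.continuous_fderiv one_ne_zero).memLp_of_hasCompactSupport
      (h2u.fderiv (𝕜 := ℝ))).eLpNorm_ne_top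
  rw [dLpN_one_eq, lpN, lpN, ENNReal.toReal_rpow, ENNReal.toReal_rpow, ← ENNReal.coe_toReal C,
    ← ENNReal.toReal_mul, ← ENNReal.toReal_mul]
  refine ENNReal.toReal_mono ?_ (hC u hu h2u)
  exact ENNReal.mul_ne_top (ENNReal.mul_ne_top ENNReal.coe_ne_top
    (ENNReal.rpow_ne_top_of_nonneg (by linarith) hfin)) hfin'

/-- The Gagliardo–Nirenberg inequality at an exponent `t = γ * d` for which the Hölder exponent
`(γ - 1) * q'` lies between `m` and `t`. -/
theorem exists_gagliardoNirenberg_of_le {n : ℕ} {d q q' γ m : ℝ} (hd : Real.HolderConjugate n d)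
    (hq : Real.HolderConjugate q q') (hm : 0 < m) (hmt : m < γ * d)
    (hms : m ≤ (γ - 1) * q') (hst : (γ - 1) * q' ≤ γ * d) :
    ∃ C : ℝ, 0 ≤ C ∧ ∀ u : EuclideanSpace ℝ (Fin n) → ℝ, ContDiff ℝ 1 u → HasCompactSupport u →
      lpN n (γ * d) u ≤
        C * lpN n m u ^ (1 - (1 / m - 1 / (γ * d)) / (1 / m - 1 / q + 1 / (n : ℝ))) *
          dLpN n 1 q u ^ ((1 / m - 1 / (γ * d)) / (1 / m - 1 / q + 1 / (n : ℝ))) := by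
  have hq'0 : 0 < q' := hq.symm.pos
  have hd0 : 0 < d := hd.symm.pos
  have hγ : 1 < γ := by
    by_contra h
    nlinarith
  have ht0 : 0 < γ * d := hm.trans hmt
  have hs0 : 0 < (γ - 1) * q' := hm.trans_le hms
  obtain ⟨C, hC, hCu⟩ := exists_lpN_rpow_le_dLpN hd hq hγ
  have hD : 0 < 1 / m - 1 / (γ * d) := sub_pos.2 (one_div_lt_one_div_of_lt hm hmt)
  have h1 : 1 / (γ * d) ≤ 1 / ((γ - 1) * q') := one_div_le_one_div_of_le hs0 hst
  have h2 : 1 / ((γ - 1) * q') ≤ 1 / m := one_div_le_one_div_of_le hm hms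
  set θ := (1 / m - 1 / ((γ - 1) * q')) / (1 / m - 1 / (γ * d)) with hθ
  have hθ₀ : 0 ≤ θ := div_nonneg (by linarith) hD.le
  have hθ₁ : θ ≤ 1 := (div_le_one hD).2 (by linarith)
  have hθD : θ * (1 / m - 1 / (γ * d)) = 1 / m - 1 / ((γ - 1) * q') := div_mul_cancel₀ _ hD.ne'
  have hexp : (1 / m - 1 / (γ * d)) * (1 + (1 - θ) * (γ - 1)) = 1 / m - 1 / q + 1 / (n : ℝ) := by
    have e1 : 1 / q = 1 - 1 / q' := by
      have := hq.inv_add_inv_eq_one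
      simp only [one_div]; linarith
    have e2 : 1 / (n : ℝ) = 1 - 1 / d := by
      have := hd.inv_add_inv_eq_one
      simp only [one_div]; linarith
    have e3 : 1 / ((γ - 1) * q') * (γ - 1) = 1 / q' := by
      have : γ - 1 ≠ 0 := by linarith
      field_simp
    have e4 : 1 / (γ * d) * γ = 1 / d := by
      have : γ ≠ 0 := by linarith
      field_simp
    linear_combination (-(γ - 1)) * hθD + e3 - e4 + e1 - e2
  have hk : 0 < 1 + (1 - θ) * (γ - 1) := by
    have := mul_nonneg (sub_nonneg.2 hθ₁) (sub_pos.2 hγ).le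
    linarith
  refine ⟨C ^ ((1 / m - 1 / (γ * d)) / (1 / m - 1 / q + 1 / (n : ℝ))), by positivity,
    fun u hu h2u ↦ ?_⟩
  refine le_mul_rpow_of_rpow_le hC (lpN_nonneg ..) (lpN_nonneg ..) (lpN_nonneg ..)
    (dLpN_nonneg ..) hγ hθ₁ ?_ (hCu u hu h2u)
    (lpN_le_rpow_mul_rpow hm hs0 ht0 hθ₀ hθ₁ ?_ hu.continuous h2u)
  · rw [div_mul_eq_mul_div, hexp, div_self]
    rw [← hexp]
    positivity
  · linear_combination hθD

/-- The Gagliardo–Nirenberg inequality for smooth compactly supported functions. -/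
theorem exists_gagliardoNirenberg {n : ℕ} (hn : 3 ≤ n) {q m p : ℝ} (hq : 2 ≤ q)
    (hm : 2 ≤ m) (hmp : m < p)
    (hpq : q < (n : ℝ) → p ≤ (n : ℝ) * q / ((n : ℝ) - q)) :
    ∃ C : ℝ, 0 ≤ C ∧ ∀ u : EuclideanSpace ℝ (Fin n) → ℝ, ContDiff ℝ 1 u → HasCompactSupport u →
      lpN n p u ≤
        C * lpN n m u ^ (1 - (1 / m - 1 / p) / (1 / m - 1 / q + 1 / (n : ℝ))) *
          dLpN n 1 q u ^ ((1 / m - 1 / p) / (1 / m - 1 / q + 1 / (n : ℝ))) := by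
  have hn3 : (3 : ℝ) ≤ n := by exact_mod_cast hn
  have hm0 : 0 < m := by linarith
  have hp0 : 0 < p := by linarith
  obtain ⟨d, hd⟩ : ∃ d : ℝ, Real.HolderConjugate n d := ⟨_, .conjExponent (by linarith)⟩
  obtain ⟨q', hq'⟩ : ∃ q' : ℝ, Real.HolderConjugate q q' := ⟨_, .conjExponent (by linarith)⟩
  have hd0 : 0 < d := hd.symm.pos
  have hq'0 : 0 < q' := hq'.symm.pos
  obtain ⟨γ, hpt, hms, hst⟩ : ∃ γ : ℝ, p ≤ γ * d ∧ m ≤ (γ - 1) * q' ∧ (γ - 1) * q' ≤ γ * d := by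
    have hdn : d = n / (n - 1) := hd.conjugate_eq
    have hqq : q' = q / (q - 1) := hq'.conjugate_eq
    rcases lt_or_ge q n with hqn | hqn
    · have hnq : (n : ℝ) - q ≠ 0 := by linarith
      have hn1 : (n : ℝ) - 1 ≠ 0 := by linarith
      have hq1 : q - 1 ≠ 0 := by linarith
      have e1 : q * (n - 1) / (n - q) * d = n * q / (n - q) := by rw [hdn]; field_simp
      have e2 : (q * (n - 1) / (n - q) - 1) * q' = n * q / (n - q) := by
        rw [hqq]; field_simp; ring
      refine ⟨q * (n - 1) / (n - q), ?_, ?_, ?_⟩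
      · rw [e1]; exact hpq hqn
      · rw [e2]; exact hmp.le.trans (hpq hqn)
      · rw [e1, e2]
    · have hle : q' ≤ d := by
        rw [hdn, hqq, div_le_div_iff₀ (by linarith) (by linarith)]
        nlinarith
      refine ⟨max (p / d) (1 + m / q'), ?_, ?_, ?_⟩
      · rw [← div_le_iff₀ hd0]; exact le_max_left _ _
      · rw [← div_le_iff₀ hq'0]; linarith [le_max_right (p / d) (1 + m / q')]
      · have : 0 < m / q' := by positivity
        have := le_max_right (p / d) (1 + m / q')
        nlinarith
  have hmt : m < γ * d := hmp.trans_le hpt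
  have ht0 : 0 < γ * d := hm0.trans hmt
  obtain ⟨C, hC, hCu⟩ := exists_gagliardoNirenberg_of_le hd hq' hm0 hmt hms hst
  have hD : 0 < 1 / m - 1 / (γ * d) := sub_pos.2 (one_div_lt_one_div_of_lt hm0 hmt)
  have h1 : 1 / (γ * d) ≤ 1 / p := one_div_le_one_div_of_le hp0 hpt
  have h2 : 1 / p < 1 / m := one_div_lt_one_div_of_lt hm0 hmp
  set a := (1 / m - 1 / (γ * d)) / (1 / m - 1 / q + 1 / (n : ℝ)) with ha
  set θ := (1 / m - 1 / p) / (1 / m - 1 / (γ * d)) with hθ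
  have hθ₀ : 0 ≤ θ := div_nonneg (by linarith) hD.le
  have hθ₁ : θ ≤ 1 := (div_le_one hD).2 (by linarith)
  have hθD : θ * (1 / m - 1 / (γ * d)) = 1 / m - 1 / p := div_mul_cancel₀ _ hD.ne'
  have haθ : (1 / m - 1 / p) / (1 / m - 1 / q + 1 / (n : ℝ)) = a * θ := by
    rw [← hθD, ha]; ring
  refine ⟨C ^ θ, by positivity, fun u hu h2u ↦ ?_⟩
  have hM := lpN_nonneg n m u
  have hG := dLpN_nonneg n 1 q u
  rcases hM.eq_or_lt with hM0 | hMpos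
  · have hzero : u = 0 := by
      have h0 : eLpNorm u (ENNReal.ofReal m) volume = 0 :=
        ((ENNReal.toReal_eq_zero_iff _).1 hM0.symm).resolve_right
          (hu.continuous.memLp_of_hasCompactSupport h2u).eLpNorm_ne_top
      rwa [eLpNorm_eq_zero_iff hu.continuous.aestronglyMeasurable (by simpa using hm0),
        hu.continuous.ae_eq_iff_eq volume continuous_zero] at h0
    have : lpN n p u = 0 := by simp [lpN, hzero]
    rw [this]
    positivity
  rw [haθ]
  calc lpN n p u ≤ lpN n m u ^ (1 - θ) * lpN n (γ * d) u ^ θ :=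
        lpN_le_rpow_mul_rpow hm0 hp0 ht0 hθ₀ hθ₁ (by linear_combination hθD) hu.continuous h2u
    _ ≤ lpN n m u ^ (1 - θ) * (C * lpN n m u ^ (1 - a) * dLpN n 1 q u ^ a) ^ θ := by
        gcongr
        · exact lpN_nonneg ..
        · exact hCu u hu h2u
    _ = _ := by
        rw [Real.mul_rpow (by positivity) (by positivity), Real.mul_rpow hC (by positivity),
          ← Real.rpow_mul hM, ← Real.rpow_mul hG,
          show 1 - a * θ = (1 - θ) + (1 - a) * θ by ring, Real.rpow_add hMpos]
        ring

theorem stmt9 (n : ℕ) (hn : 3 ≤ n) (q m p : ℝ) (hq : 2 ≤ q)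
    (hm : 2 ≤ m) (hmp : m ≤ p)
    (hpq : q < (n : ℝ) → p ≤ (n : ℝ) * q / ((n : ℝ) - q)) :
    ∃ C : ℝ, ∀ A B : ℝ, SobolevPair n A B →
      ∀ u : EuclideanSpace ℝ (Fin n) → ℝ, ContDiff ℝ (⊤ : ℕ∞) u → HasCompactSupport u →
        lpN n p u ≤
          C * (lpN n m u) ^ (1 - (1 / m - 1 / p) / (1 / m - 1 / q + 1 / (n : ℝ))) *
            (A * dLpN n 1 q u + B * lpN n q u) ^
              ((1 / m - 1 / p) / (1 / m - 1 / q + 1 / (n : ℝ))) := by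
  rcases hmp.eq_or_lt with rfl | hmp'
  · exact ⟨1, fun A B _ u _ _ ↦ by simp⟩
  obtain ⟨a, ha0, ha⟩ := exists_pos_le_of_sobolevPair n hn
  obtain ⟨C, hC, hCu⟩ := exists_gagliardoNirenberg hn hq hm hmp' hpq
  have hn3 : (3 : ℝ) ≤ n := by exact_mod_cast hn
  have hα : 0 ≤ (1 / m - 1 / p) / (1 / m - 1 / q + 1 / (n : ℝ)) := by
    have h2 : 1 / p < 1 / m := one_div_lt_one_div_of_lt (by linarith) hmp'
    refine div_nonneg (by linarith) ?_
    rcases lt_or_ge q n with hqn | hqn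
    · have h := one_div_le_one_div_of_le (by linarith) (hpq hqn)
      have e : 1 / ((n : ℝ) * q / (n - q)) = 1 / q - 1 / n := by
        have : (n : ℝ) - q ≠ 0 := by linarith
        field_simp
      linarith
    · have h := one_div_le_one_div_of_le (by linarith) hqn
      have : 0 < 1 / p := one_div_pos.2 (by linarith)
      linarith
  set α := (1 / m - 1 / p) / (1 / m - 1 / q + 1 / (n : ℝ))
  refine ⟨C * (a⁻¹) ^ α, fun A B hAB u hu h2u ↦ ?_⟩
  have hM := lpN_nonneg n m u
  have hG := dLpN_nonneg n 1 q u
  have hle : dLpN n 1 q u ≤ a⁻¹ * (A * dLpN n 1 q u + B * lpN n q u) := by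
    rw [inv_mul_eq_div, le_div_iff₀ ha0]
    nlinarith [ha A B hAB, mul_nonneg hAB.2.1.le (lpN_nonneg n q u)]
  have hnonneg : 0 ≤ A * dLpN n 1 q u + B * lpN n q u :=
    add_nonneg (mul_nonneg hAB.1.le hG) (mul_nonneg hAB.2.1.le (lpN_nonneg n q u))
  calc lpN n p u ≤ C * lpN n m u ^ (1 - α) * dLpN n 1 q u ^ α :=
        hCu u (hu.of_le (by exact_mod_cast le_top)) h2u
    _ ≤ C * lpN n m u ^ (1 - α) * (a⁻¹ * (A * dLpN n 1 q u + B * lpN n q u)) ^ α := by gcongr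
    _ = _ := by
        rw [Real.mul_rpow (by positivity) hnonneg]
        ring
end

section
/- Let n ≥ 1, let k be a positive integer, let p ∈ [1,∞], and let A, B > 0. There exists a constant C depending only on n, k, p such that for every integer 0 ≤ j ≤ k and every smooth compactly supported u : ℝⁿ → ℝ: Aʲ·B^{k−j}·‖∇ʲu‖_p ≤ C·( Aᵏ‖∇ᵏu‖_p + Bᵏ‖u‖_p ). -/
open MeasureTheory ENNReal

/-- The `L^p` norm of the pointwise norm of the `k`-th iterated derivative,
with an extended-real exponent. -/
noncomputable def dLpE (n k : ℕ) (p : ℝ≥0∞) (u : EuclideanSpace ℝ (Fin n) → ℝ) : ℝ :=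
  (eLpNorm (fun x => ‖iteratedFDeriv ℝ k u x‖) p volume).toReal

/-- Averaging the translates of a continuous function against a probability measure does not
increase its `L^p` norm. -/
lemma eLpNorm_lintegral_translate_le {E G : Type*} [NormedAddCommGroup E] [NormedSpace ℝ E]
    [FiniteDimensional ℝ E] [MeasurableSpace E] [BorelSpace E] [NormedAddCommGroup G]
    {μ : Measure E} [μ.IsAddHaarMeasure] {ν : Measure ℝ} [IsProbabilityMeasure ν]
    {h : E → G} (hh : Continuous h) (v : E) {p : ℝ≥0∞} (hp : 1 ≤ p) :
    eLpNorm (fun x => ∫⁻ s, ‖h (x + s • v)‖ₑ ∂ν) p μ ≤ eLpNorm h p μ := by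
  have hp0 : p ≠ 0 := (zero_lt_one.trans_le hp).ne'
  rcases eq_or_ne p ∞ with rfl | hpt
  · have hle : ∀ x, ‖h x‖ₑ ≤ eLpNorm h ∞ μ := by
      have hcl : IsClosed {x | ‖h x‖ₑ ≤ eLpNorm h ∞ μ} :=
        isClosed_le hh.enorm continuous_const
      have hd : Dense {x | ‖h x‖ₑ ≤ eLpNorm h ∞ μ} := by
        rw [eLpNorm_exponent_top]
        exact Measure.dense_of_ae (enorm_ae_le_eLpNormEssSup h μ)
      intro x
      have := hd.closure_eq ▸ Set.mem_univ x
      rwa [hcl.closure_eq] at this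
    rw [eLpNorm_exponent_top]
    refine essSup_le_of_ae_le _ (Filter.Eventually.of_forall fun x => ?_)
    calc ‖∫⁻ s, ‖h (x + s • v)‖ₑ ∂ν‖ₑ = ∫⁻ s, ‖h (x + s • v)‖ₑ ∂ν := enorm_eq_self _
      _ ≤ ∫⁻ _, eLpNorm h ∞ μ ∂ν := lintegral_mono fun s => hle _
      _ = eLpNorm h ∞ μ := by simp
  · have hpr : 0 < p.toReal := ENNReal.toReal_pos hp0 hpt
    rw [eLpNorm_eq_lintegral_rpow_enorm_toReal hp0 hpt,
      eLpNorm_eq_lintegral_rpow_enorm_toReal hp0 hpt]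
    refine ENNReal.rpow_le_rpow ?_ (by positivity)
    have jensen : ∀ x, ‖∫⁻ s, ‖h (x + s • v)‖ₑ ∂ν‖ₑ ^ p.toReal
        ≤ ∫⁻ s, ‖h (x + s • v)‖ₑ ^ p.toReal ∂ν := by
      intro x
      have hc : Continuous fun s : ℝ => h (x + s • v) := by fun_prop
      have h1 := eLpNorm_le_eLpNorm_of_exponent_le (μ := ν) hp hc.aestronglyMeasurable
      rw [eLpNorm_one_eq_lintegral_enorm, eLpNorm_eq_lintegral_rpow_enorm_toReal hp0 hpt] at h1
      rw [enorm_eq_self]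
      calc _ ≤ _ := ENNReal.rpow_le_rpow h1 hpr.le
        _ = _ := by rw [← ENNReal.rpow_mul, one_div_mul_cancel hpr.ne', ENNReal.rpow_one]
    calc _ ≤ ∫⁻ x, ∫⁻ s, ‖h (x + s • v)‖ₑ ^ p.toReal ∂ν ∂μ := lintegral_mono jensen
      _ = ∫⁻ s, ∫⁻ x, ‖h (x + s • v)‖ₑ ^ p.toReal ∂μ ∂ν := by
        refine lintegral_lintegral_swap ?_
        have hc : Continuous fun z : E × ℝ => ‖h (z.1 + z.2 • v)‖ₑ := by fun_prop
        exact (hc.measurable.pow_const _).aemeasurable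
      _ = ∫⁻ _, ∫⁻ x, ‖h x‖ₑ ^ p.toReal ∂μ ∂ν := by
        refine lintegral_congr fun s => ?_
        exact lintegral_add_right_eq_self (fun x => ‖h x‖ₑ ^ p.toReal) (s • v)
      _ = _ := by simp

/-- First-order Taylor expansion with integral remainder, as a bound on the derivative. -/
lemma enorm_fderiv_apply_le {E F : Type*} [NormedAddCommGroup E] [NormedSpace ℝ E]
    [NormedAddCommGroup F] [NormedSpace ℝ F] [CompleteSpace F] {f : E → F}
    (hf : ContDiff ℝ 2 f) (x v : E) :
    ‖fderiv ℝ f x v‖ₑ ≤ ‖f (x + v)‖ₑ + ‖f x‖ₑ +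
      ‖v‖ₑ ^ 2 * ∫⁻ s in Set.Ioc (0 : ℝ) 1, ‖fderiv ℝ (fderiv ℝ f) (x + s • v)‖ₑ := by
  have hf1 : ContDiff ℝ 1 (fderiv ℝ f) := hf.fderiv_right (by norm_num)
  have hf2 : Continuous (fderiv ℝ (fderiv ℝ f)) := hf1.continuous_fderiv (by norm_num)
  have hline : ∀ s : ℝ, HasDerivAt (fun s : ℝ => x + s • v) v s := fun s => by
    simpa using ((hasDerivAt_id s).smul_const v).const_add x
  have hderiv : ∀ s : ℝ, HasDerivAt
      (fun s : ℝ => f (x + s • v) + (1 - s) • fderiv ℝ f (x + s • v) v)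
      ((1 - s) • fderiv ℝ (fderiv ℝ f) (x + s • v) v v) s := by
    intro s
    have d1 :=
      (hf.differentiable (by norm_num) (x + s • v)).hasFDerivAt.comp_hasDerivAt s (hline s)
    have d2 :=
      (hf1.differentiable (by norm_num) (x + s • v)).hasFDerivAt.comp_hasDerivAt s (hline s)
    have d3 := d2.clm_apply (hasDerivAt_const s v)
    have d4 := ((hasDerivAt_id s).const_sub 1).smul d3
    refine (d1.add d4).congr_deriv ?_
    simp
  have hint : ∫ s in (0 : ℝ)..1, (1 - s) • fderiv ℝ (fderiv ℝ f) (x + s • v) v v =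
      f (x + v) - (f x + fderiv ℝ f x v) := by
    rw [intervalIntegral.integral_eq_sub_of_hasDerivAt (fun s _ => hderiv s)
      (Continuous.intervalIntegrable (by fun_prop) _ _)]
    simp
  have hrem : fderiv ℝ f x v = f (x + v) - f x -
      ∫ s in Set.Ioc (0 : ℝ) 1, (1 - s) • fderiv ℝ (fderiv ℝ f) (x + s • v) v v := by
    rw [← intervalIntegral.integral_of_le zero_le_one, hint]
    abel
  rw [hrem]
  refine enorm_sub_le.trans (add_le_add enorm_sub_le ?_)
  refine (enorm_integral_le_lintegral_enorm _).trans ?_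
  rw [← lintegral_const_mul' _ _ (by simp)]
  refine setLIntegral_mono' measurableSet_Ioc fun s hs => ?_
  rw [← ofReal_norm, ← ofReal_norm v, ← ofReal_norm, ← ENNReal.ofReal_pow (norm_nonneg _),
    ← ENNReal.ofReal_mul (by positivity)]
  refine ENNReal.ofReal_le_ofReal ?_
  have hs1 : ‖1 - s‖ ≤ 1 := by
    rw [Real.norm_eq_abs, abs_le]; constructor <;> linarith [hs.1, hs.2]
  calc ‖(1 - s) • fderiv ℝ (fderiv ℝ f) (x + s • v) v v‖
      ≤ 1 * (‖fderiv ℝ (fderiv ℝ f) (x + s • v)‖ * ‖v‖ * ‖v‖) := by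
        rw [norm_smul]
        gcongr
        exact ContinuousLinearMap.le_opNorm₂ _ _ _
    _ = _ := by ring

lemma opNorm_le_sum_norm_apply_single {ι F : Type*} [Fintype ι] [DecidableEq ι]
    [NormedAddCommGroup F] [NormedSpace ℝ F] (T : EuclideanSpace ℝ ι →L[ℝ] F) :
    ‖T‖ ≤ ∑ i, ‖T (EuclideanSpace.single i 1)‖ := by
  refine T.opNorm_le_bound (by positivity) fun x => ?_
  have hx : x = ∑ i, x i • EuclideanSpace.single i (1 : ℝ) := by
    simpa using ((EuclideanSpace.basisFun ι ℝ).sum_repr x).symm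
  calc ‖T x‖ = ‖∑ i, x i • T (EuclideanSpace.single i 1)‖ := by
        conv_lhs => rw [hx]
        simp [map_sum]
    _ ≤ ∑ i, ‖x i • T (EuclideanSpace.single i 1)‖ := norm_sum_le _ _
    _ ≤ ∑ i, ‖T (EuclideanSpace.single i 1)‖ * ‖x‖ := by
        refine Finset.sum_le_sum fun i _ => ?_
        rw [norm_smul, mul_comm]
        gcongr
        exact PiLp.norm_apply_le x i
    _ = _ := by rw [Finset.sum_mul]

/-- Bound on a directional derivative in `L^p` by the function and its second derivative. -/
lemma eLpNorm_fderiv_apply_le {E F : Type*} [NormedAddCommGroup E] [NormedSpace ℝ E]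
    [FiniteDimensional ℝ E] [MeasurableSpace E] [BorelSpace E] {μ : Measure E}
    [μ.IsAddHaarMeasure] [NormedAddCommGroup F] [NormedSpace ℝ F] [CompleteSpace F] {f : E → F}
    (hf : ContDiff ℝ 2 f) (v : E) {p : ℝ≥0∞} (hp : 1 ≤ p) :
    eLpNorm (fun x => fderiv ℝ f x v) p μ ≤
      2 * eLpNorm f p μ + ‖v‖ₑ ^ 2 * eLpNorm (fderiv ℝ (fderiv ℝ f)) p μ := by
  have hf1 : ContDiff ℝ 1 (fderiv ℝ f) := hf.fderiv_right (by norm_num)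
  have hf2 : Continuous (fderiv ℝ (fderiv ℝ f)) := hf1.continuous_fderiv (by norm_num)
  have hfc := hf.continuous
  have : IsProbabilityMeasure (volume.restrict (Set.Ioc (0 : ℝ) 1)) := ⟨by simp⟩
  set R : E → ℝ≥0∞ := fun x =>
    ∫⁻ s in Set.Ioc (0 : ℝ) 1, ‖fderiv ℝ (fderiv ℝ f) (x + s • v)‖ₑ
  have hRm : Measurable R := by
    have hc : Continuous fun z : E × ℝ => ‖fderiv ℝ (fderiv ℝ f) (z.1 + z.2 • v)‖ₑ := by fun_prop
    exact hc.measurable.lintegral_prod_right'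
  have hRle : eLpNorm R p μ ≤ eLpNorm (fderiv ℝ (fderiv ℝ f)) p μ :=
    eLpNorm_lintegral_translate_le (ν := volume.restrict (Set.Ioc (0 : ℝ) 1))
      (h := fderiv ℝ (fderiv ℝ f)) hf2 v hp
  have htr : eLpNorm (fun x => ‖f (x + v)‖ₑ) p μ = eLpNorm f p μ := by
    rw [eLpNorm_enorm]
    exact eLpNorm_comp_measurePreserving hfc.aestronglyMeasurable
      (measurePreserving_add_right μ v)
  calc eLpNorm (fun x => fderiv ℝ f x v) p μ
      ≤ eLpNorm ((fun x => ‖f (x + v)‖ₑ) + (fun x => ‖f x‖ₑ) + fun x => ‖v‖ₑ ^ 2 * R x) p μ :=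
        eLpNorm_mono_enorm fun x => by
          simpa using enorm_fderiv_apply_le hf x v
    _ ≤ eLpNorm (fun x => ‖f (x + v)‖ₑ) p μ + eLpNorm (fun x => ‖f x‖ₑ) p μ +
          eLpNorm (fun x => ‖v‖ₑ ^ 2 * R x) p μ := by
        have m1 : AEStronglyMeasurable (fun x => ‖f (x + v)‖ₑ) μ :=
          Continuous.aestronglyMeasurable (by fun_prop)
        have m2 : AEStronglyMeasurable (fun x => ‖f x‖ₑ) μ :=
          Continuous.aestronglyMeasurable (by fun_prop)
        refine (eLpNorm_add_le (m1.add m2)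
          (hRm.const_mul _).aestronglyMeasurable hp).trans ?_
        gcongr
        exact eLpNorm_add_le m1 m2 hp
    _ ≤ eLpNorm f p μ + eLpNorm f p μ +
          ‖v‖ₑ ^ 2 * eLpNorm (fderiv ℝ (fderiv ℝ f)) p μ := by
        rw [htr, eLpNorm_enorm]
        gcongr
        have hle : eLpNorm (fun x => ‖v‖ₑ ^ 2 * R x) p μ ≤ ‖v‖ₑ ^ 2 * eLpNorm R p μ := by
          have := eLpNorm_le_nnreal_smul_eLpNorm_of_ae_le_mul' (μ := μ)
            (f := fun x => ‖v‖ₑ ^ 2 * R x) (g := R) (c := ‖v‖₊ ^ 2)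
            (Filter.Eventually.of_forall fun x => by simp [enorm_eq_nnnorm]) p
          simpa [ENNReal.smul_def, enorm_eq_nnnorm] using this
        exact hle.trans (by gcongr)
    _ = _ := by rw [two_mul]

/-- Interpolation of the first derivative in `L^p` between the function and its second
derivative, with a free scale `t`. -/
lemma eLpNorm_fderiv_le {ι F : Type*} [Fintype ι] [NormedAddCommGroup F] [NormedSpace ℝ F]
    [CompleteSpace F] {f : EuclideanSpace ℝ ι → F} (hf : ContDiff ℝ 2 f) {p : ℝ≥0∞} (hp : 1 ≤ p)
    {t : ℝ} (ht : 0 < t) :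
    ENNReal.ofReal t * eLpNorm (fderiv ℝ f) p volume ≤ Fintype.card ι *
      (2 * eLpNorm f p volume +
        ENNReal.ofReal t ^ 2 * eLpNorm (fderiv ℝ (fderiv ℝ f)) p volume) := by
  classical
  have hf1 : ContDiff ℝ 1 (fderiv ℝ f) := hf.fderiv_right (by norm_num)
  have hc := hf1.continuous
  have ht' : ENNReal.ofReal t = ‖t‖ₑ := by rw [Real.enorm_of_nonneg ht.le]
  calc ENNReal.ofReal t * eLpNorm (fderiv ℝ f) p volume
      = eLpNorm (t • fderiv ℝ f) p volume := by rw [ht', ← eLpNorm_const_smul t]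
    _ ≤ eLpNorm (∑ i, fun x => ‖fderiv ℝ f x (t • EuclideanSpace.single i (1 : ℝ))‖) p
          volume := by
        refine eLpNorm_mono_real fun x => ?_
        simpa using opNorm_le_sum_norm_apply_single (t • fderiv ℝ f x)
    _ ≤ ∑ i, eLpNorm (fun x => ‖fderiv ℝ f x (t • EuclideanSpace.single i (1 : ℝ))‖) p
          volume :=
        eLpNorm_sum_le (fun i _ => Continuous.aestronglyMeasurable (by fun_prop)) hp
    _ ≤ ∑ _i : ι, (2 * eLpNorm f p volume +
          ENNReal.ofReal t ^ 2 * eLpNorm (fderiv ℝ (fderiv ℝ f)) p volume) := by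
        refine Finset.sum_le_sum fun i _ => ?_
        rw [eLpNorm_norm]
        refine (eLpNorm_fderiv_apply_le hf (t • EuclideanSpace.single i (1 : ℝ)) hp).trans_eq ?_
        have : ‖t • EuclideanSpace.single i (1 : ℝ)‖ₑ = ENNReal.ofReal t := by
          rw [ht', ← ofReal_norm, norm_smul, PiLp.norm_single,
            norm_one, mul_one, ofReal_norm]
        rw [this]
    _ = _ := by simp only [Finset.sum_const, Finset.card_univ, nsmul_eq_mul]

set_option maxSynthPendingDepth 3 in
lemma norm_fderiv_fderiv_iteratedFDeriv {E F : Type*} [NormedAddCommGroup E] [NormedSpace ℝ E]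
    [NormedAddCommGroup F] [NormedSpace ℝ F] (u : E → F) (j : ℕ) (x : E) :
    ‖fderiv ℝ (fderiv ℝ (iteratedFDeriv ℝ j u)) x‖ = ‖iteratedFDeriv ℝ (j + 2) u x‖ := by
  rw [fderiv_iteratedFDeriv, LinearIsometryEquiv.comp_fderiv, ← norm_fderiv_iteratedFDeriv]
  exact LinearIsometry.norm_toContinuousLinearMap_comp
    (continuousMultilinearCurryLeftEquiv ℝ (fun _ : Fin (j + 1) => E) F).toLinearIsometry

set_option maxSynthPendingDepth 3 in
/-- Interpolation inequality for consecutive derivatives of a test function. -/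
lemma dLpE_succ_le {n : ℕ} (j : ℕ) {p : ℝ≥0∞} (hp : 1 ≤ p) {u : EuclideanSpace ℝ (Fin n) → ℝ}
    (hu : ContDiff ℝ (⊤ : ℕ∞) u) (hsupp : HasCompactSupport u) {t : ℝ} (ht : 0 < t) :
    t * dLpE n (j + 1) p u ≤ n * (2 * dLpE n j p u + t ^ 2 * dLpE n (j + 2) p u) := by
  have htop : ∀ i : ℕ, (i : WithTop ℕ∞) ≤ ((⊤ : ℕ∞) : WithTop ℕ∞) := fun i => by
    exact_mod_cast le_top
  have hfin : ∀ i, eLpNorm (fun x => ‖iteratedFDeriv ℝ i u x‖) p volume ≠ ∞ := fun i =>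
    ((hu.continuous_iteratedFDeriv (htop i)).memLp_of_hasCompactSupport
      (hsupp.iteratedFDeriv i)).norm.eLpNorm_ne_top
  have hf : ContDiff ℝ 2 (iteratedFDeriv ℝ j u) :=
    (hu.of_le (htop (2 + j))).iteratedFDeriv_right
      (by norm_cast)
  have key := eLpNorm_fderiv_le hf hp ht
  rw [← eLpNorm_norm (fderiv ℝ (iteratedFDeriv ℝ j u)),
    ← eLpNorm_norm (fderiv ℝ (fderiv ℝ (iteratedFDeriv ℝ j u))),
    ← eLpNorm_norm (iteratedFDeriv ℝ j u)] at key
  simp only [norm_fderiv_fderiv_iteratedFDeriv, norm_fderiv_iteratedFDeriv, Fintype.card_fin]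
    at key
  have h2 : (2 : ℝ≥0∞) * eLpNorm (fun x => ‖iteratedFDeriv ℝ j u x‖) p volume ≠ ∞ :=
    ENNReal.mul_ne_top (by simp) (hfin j)
  have h3 : ENNReal.ofReal t ^ 2 *
      eLpNorm (fun x => ‖iteratedFDeriv ℝ (j + 2) u x‖) p volume ≠ ∞ :=
    ENNReal.mul_ne_top (by simp) (hfin _)
  have := ENNReal.toReal_mono
    (ENNReal.mul_ne_top (by simp) (ENNReal.add_ne_top.2 ⟨h2, h3⟩)) key
  rw [ENNReal.toReal_mul, ENNReal.toReal_mul, ENNReal.toReal_add h2 h3, ENNReal.toReal_mul,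
    ENNReal.toReal_mul, ENNReal.toReal_pow, ENNReal.toReal_ofReal ht.le] at this
  simpa [dLpE] using this

/-- A sequence whose consecutive terms interpolate satisfies `c m ≤ δ * c (m + 1) + C * c 0`. -/
lemma exists_le_small_succ_add_zero {K : ℝ} (hK : 0 < K) (m : ℕ) : ∀ δ : ℝ, 0 < δ →
    ∃ C : ℝ, 0 ≤ C ∧ ∀ c : ℕ → ℝ, (∀ j, 0 ≤ c j) →
      (∀ j, ∀ ε : ℝ, 0 < ε → c (j + 1) ≤ K * (ε * c (j + 2) + c j / ε)) →
      c m ≤ δ * c (m + 1) + C * c 0 := by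
  induction m with
  | zero =>
    exact fun δ hδ => ⟨1, zero_le_one, fun c hc _ => by nlinarith [mul_nonneg hδ.le (hc 1)]⟩
  | succ m ih =>
    intro δ hδ
    obtain ⟨C, hC, h⟩ := ih (δ / (4 * K ^ 2)) (by positivity)
    refine ⟨4 * K ^ 2 / δ * C, by positivity, fun c hc hstep => ?_⟩
    have h1 := h c hc hstep
    have h2 := hstep m (δ / (2 * K)) (by positivity)
    have h3 : K * (δ / (2 * K) * c (m + 2) + c m / (δ / (2 * K))) =
        δ / 2 * c (m + 2) + 2 * K ^ 2 / δ * c m := by field_simp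
    have h4 := mul_le_mul_of_nonneg_left h1 (show 0 ≤ 2 * K ^ 2 / δ by positivity)
    have h5 : 2 * K ^ 2 / δ * (δ / (4 * K ^ 2) * c (m + 1) + C * c 0) =
        c (m + 1) / 2 + 2 * K ^ 2 / δ * C * c 0 := by
      field_simp
      ring
    have h6 : 4 * K ^ 2 / δ * C * c 0 = 2 * (2 * K ^ 2 / δ * C * c 0) := by ring
    rw [h6]
    linarith

/-- A sequence whose consecutive terms interpolate is controlled by its endpoints. -/
lemma exists_le_endpoints {K : ℝ} (hK : 0 < K) (k : ℕ) :
    ∃ C : ℝ, 1 ≤ C ∧ ∀ c : ℕ → ℝ, (∀ j, 0 ≤ c j) →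
      (∀ j, ∀ ε : ℝ, 0 < ε → c (j + 1) ≤ K * (ε * c (j + 2) + c j / ε)) →
      ∀ j ≤ k, c j ≤ C * (c k + c 0) := by
  induction k with
  | zero =>
    refine ⟨1, le_rfl, fun c hc _ j hj => ?_⟩
    obtain rfl : j = 0 := by omega
    linarith [hc 0]
  | succ k ih =>
    obtain ⟨C, hC, h⟩ := ih
    obtain ⟨D, hD, h'⟩ := exists_le_small_succ_add_zero hK k 1 one_pos
    refine ⟨C * (1 + D), by nlinarith, fun c hc hstep j hj => ?_⟩
    have hk1 := hc (k + 1)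
    have h0 := hc 0
    rcases hj.eq_or_lt with rfl | hj
    · have : 1 ≤ C * (1 + D) := by nlinarith
      nlinarith
    · calc c j ≤ C * (c k + c 0) := h c hc hstep j (by omega)
        _ ≤ C * ((1 + D) * (c (k + 1) + c 0)) := by
          have := h' c hc hstep
          gcongr
          nlinarith [mul_nonneg hD hk1]
        _ = _ := by ring

theorem stmt16 (n : ℕ) (hn : 1 ≤ n) (k : ℕ) (hk : 0 < k) (p : ℝ≥0∞) (hp : 1 ≤ p) :
    ∃ C : ℝ, ∀ A B : ℝ, 0 < A → 0 < B → ∀ j : ℕ, j ≤ k →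
      ∀ u : EuclideanSpace ℝ (Fin n) → ℝ, ContDiff ℝ (⊤ : ℕ∞) u → HasCompactSupport u →
        A ^ j * B ^ (k - j) * dLpE n j p u ≤
          C * (A ^ k * dLpE n k p u + B ^ k * dLpE n 0 p u) := by
  have hn' : (0 : ℝ) < n := by exact_mod_cast hn
  obtain ⟨C, -, h⟩ := exists_le_endpoints (show (0 : ℝ) < 2 * n by positivity) k
  refine ⟨C, fun A B hA hB j hj u hu hsupp => ?_⟩
  have hnonneg : ∀ i, 0 ≤ dLpE n i p u := fun i => ENNReal.toReal_nonneg
  have key := h (fun i => (A / B) ^ i * dLpE n i p u)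
    (fun i => mul_nonneg (by positivity) (hnonneg i)) ?_ j hj
  · have hscale : ∀ i ≤ k, B ^ k * ((A / B) ^ i * dLpE n i p u) =
        A ^ i * B ^ (k - i) * dLpE n i p u := by
      intro i hi
      obtain ⟨l, rfl⟩ := Nat.exists_eq_add_of_le hi
      rw [Nat.add_sub_cancel_left, div_pow, pow_add]
      field_simp
    calc A ^ j * B ^ (k - j) * dLpE n j p u
        = B ^ k * ((A / B) ^ j * dLpE n j p u) := (hscale j hj).symm
      _ ≤ B ^ k * (C * ((A / B) ^ k * dLpE n k p u + (A / B) ^ 0 * dLpE n 0 p u)) := by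
        gcongr
      _ = C * (B ^ k * ((A / B) ^ k * dLpE n k p u) +
            B ^ k * ((A / B) ^ 0 * dLpE n 0 p u)) := by ring
      _ = _ := by rw [hscale k le_rfl, hscale 0 (Nat.zero_le k)]; simp
  · intro i ε hε
    set r := A / B
    have hr0 : 0 < r := by positivity
    have h1 := dLpE_succ_le i hp hu hsupp (show 0 < r * ε by positivity)
    have h2 := hnonneg (i + 2)
    have h3 : r ^ i / ε * (r * ε * dLpE n (i + 1) p u) = r ^ (i + 1) * dLpE n (i + 1) p u := by
      rw [pow_succ]
      field_simp
    show r ^ (i + 1) * dLpE n (i + 1) p u ≤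
      2 * n * (ε * (r ^ (i + 2) * dLpE n (i + 2) p u) + r ^ i * dLpE n i p u / ε)
    rw [← h3]
    calc _ ≤ r ^ i / ε * (n * (2 * dLpE n i p u + (r * ε) ^ 2 * dLpE n (i + 2) p u)) := by
          gcongr
      _ = n * (ε * (r ^ (i + 2) * dLpE n (i + 2) p u) + 2 * (r ^ i * dLpE n i p u / ε)) := by
          field_simp
          ring
      _ ≤ n * (2 * (ε * (r ^ (i + 2) * dLpE n (i + 2) p u)) +
            2 * (r ^ i * dLpE n i p u / ε)) := by
          refine mul_le_mul_of_nonneg_left ?_ hn'.le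
          have : 0 ≤ ε * (r ^ (i + 2) * dLpE n (i + 2) p u) := by positivity
          linarith
      _ = _ := by ring
end
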